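/- For every integer n ≥ 2, there exist elements a and b of the Higman–Thompson group T_n generating a free subgroup H of rank 2 (so the homomorphism from the free group on two generators sending the generators to a and b is injective) such that every non-trivial element of H has exactly one attracting fixed point in the circle S¹ = ℝ/ℤ. -/

import Mathlib

noncomputable section

/-- The circle `S¹ = ℝ/ℤ`. -/
abbrev Circle1 := AddCircle (1 : ℝ)

/-- The group of self-homeomorphisms of a space, with `(f * g) x = f (g x)`. -/
instance {X : Type*} [TopologicalSpace X] : Group (X ≃ₜ X) where
  mul f g := g.trans f
  one := Homeomorph.refl _
  inv := Homeomorph.symm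
  mul_assoc _ _ _ := Homeomorph.ext fun _ => rfl
  one_mul _ := Homeomorph.ext fun _ => rfl
  mul_one _ := Homeomorph.ext fun _ => rfl
  inv_mul_cancel f := Homeomorph.ext f.symm_apply_apply

/-- `x` lies in `ℤ[1/n]`. -/
def IsNAdicRational (n : ℕ) (x : ℝ) : Prop := ∃ (a : ℤ) (k : ℕ), x = (a : ℝ) / (n : ℝ) ^ k

/-- `F : ℝ → ℝ` is piecewise linear on `[0,1]` with slopes integer powers of `n` and
breakpoints in `ℤ[1/n]`. -/
def IsPiecewiseLinearN (n : ℕ) (F : ℝ → ℝ) : Prop :=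
  ∃ (k : ℕ) (x : ℕ → ℝ), 0 < k ∧ x 0 = 0 ∧ x k = 1 ∧
    (∀ i < k, x i < x (i + 1)) ∧
    (∀ i ≤ k, IsNAdicRational n (x i)) ∧
    (∀ i < k, ∃ (m : ℤ) (c : ℝ), ∀ t ∈ Set.Icc (x i) (x (i + 1)),
      F t = (n : ℝ) ^ m * t + c)

/-- Membership in the Higman–Thompson group `T_n`, viewed as a group of
orientation-preserving self-homeomorphisms of `ℝ/ℤ`: `f` lifts to a strictly increasing
homeomorphism `F` of `ℝ` commuting with translation by `1`, which is piecewise linear with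
slopes powers of `n` and breakpoints in `ℤ[1/n]`. -/
def TnMem (n : ℕ) (f : Circle1 ≃ₜ Circle1) : Prop :=
  ∃ F : ℝ ≃ₜ ℝ, StrictMono F ∧ (∀ t : ℝ, F (t + 1) = F t + 1) ∧
    (∀ t : ℝ, f ((t : ℝ) : Circle1) = ((F t : ℝ) : Circle1)) ∧
    IsPiecewiseLinearN n F

/-- `x` is an attracting fixed point of `f`: it is fixed, and there is an open
neighborhood `U` of `x` such that the iterates of every point of `U` converge to `x`. -/
def IsAttractingFixedPt {X : Type*} [TopologicalSpace X] (f : X → X) (x : X) : Prop :=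
  f x = x ∧ ∃ U : Set X, IsOpen U ∧ x ∈ U ∧
    ∀ y ∈ U, Filter.Tendsto (fun k => f^[k] y) Filter.atTop (nhds x)

open Set Filter Topology Function
open scoped NNReal

section PingPong

variable {X : Type*}

theorem Homeomorph.mul_apply' [TopologicalSpace X] (f g : X ≃ₜ X) (x : X) :
    (f * g) x = f (g x) := rfl

theorem Homeomorph.coe_mul' [TopologicalSpace X] (f g : X ≃ₜ X) : ⇑(f * g) = f ∘ g := rfl

theorem Homeomorph.coe_one' [TopologicalSpace X] : ⇑(1 : X ≃ₜ X) = id := rfl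

theorem Homeomorph.inv_apply_self' [TopologicalSpace X] (f : X ≃ₜ X) (x : X) :
    f⁻¹ (f x) = x := f.symm_apply_apply x

theorem Homeomorph.apply_inv_self' [TopologicalSpace X] (f : X ≃ₜ X) (x : X) :
    f (f⁻¹ x) = x := f.apply_symm_apply x

/-- A point is an attracting fixed point of a conjugate homeomorphism if its preimage under the
conjugator is an attracting fixed point. -/
theorem IsAttractingFixedPt.conj [TopologicalSpace X] {g : X ≃ₜ X} {x : X}
    (hx : IsAttractingFixedPt g x) (h : X ≃ₜ X) : IsAttractingFixedPt (h * g * h⁻¹) (h x) := by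
  obtain ⟨hfix, U, hU, hxU, hlim⟩ := hx
  have hsemi : Semiconj h g (h * g * h⁻¹) := fun y => by
    simp only [Homeomorph.mul_apply', Homeomorph.inv_apply_self']
  refine ⟨?_, h '' U, h.isOpenMap U hU, mem_image_of_mem h hxU, ?_⟩
  · rw [← hsemi x, hfix]
  · rintro _ ⟨y, hy, rfl⟩
    have := (h.continuous.tendsto x).comp (hlim y hy)
    refine this.congr fun k => ?_
    exact (hsemi.iterate_right k) y

theorem existsUnique_isAttractingFixedPt_conj [TopologicalSpace X] {g : X ≃ₜ X}
    (hg : ∃! x, IsAttractingFixedPt g x) (h : X ≃ₜ X) :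
    ∃! x, IsAttractingFixedPt (h * g * h⁻¹) x := by
  obtain ⟨x, hx, huniq⟩ := hg
  refine ⟨h x, hx.conj h, fun y hy => ?_⟩
  have hy' := hy.conj h⁻¹
  rw [show h⁻¹ * (h * g * h⁻¹) * h⁻¹⁻¹ = g by group] at hy'
  rw [← huniq _ hy', Homeomorph.apply_inv_self']

/-- The identity of a nonempty perfect Hausdorff space has no attracting fixed point. -/
theorem not_isAttractingFixedPt_one [TopologicalSpace X] [T2Space X] [PerfectSpace X] (x : X) :
    ¬ IsAttractingFixedPt (1 : X ≃ₜ X) x := by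
  rintro ⟨-, U, hU, hxU, hlim⟩
  obtain ⟨y, ⟨hyU, -⟩, hyx⟩ := (preperfect_iff_nhds.1 PerfectSpace.univ_preperfect) x (mem_univ x)
    U (hU.mem_nhds hxU)
  have := hlim y hyU
  simp only [Homeomorph.coe_one', iterate_id, id_eq] at this
  exact hyx (tendsto_nhds_unique tendsto_const_nhds this)

/-- North-south dynamics: a homeomorphism sending the complement of `N` into `P` and contracting
`P`, whose inverse contracts `N`, has exactly one attracting fixed point. -/
theorem existsUnique_isAttractingFixedPt_of_northSouth [MetricSpace X] [CompleteSpace X]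
    [PerfectSpace X] {g : X ≃ₜ X} {P N : Set X} {K : ℝ≥0} (hK : K < 1) (hP : IsClosed P)
    (hN : IsClosed N) (hPne : P.Nonempty) (hPN : Disjoint P N) (hgP : MapsTo g Nᶜ P)
    (hLP : LipschitzOnWith K g P) (hLN : LipschitzOnWith K ⇑g⁻¹ N) :
    ∃! x, IsAttractingFixedPt g x := by
  have hPN' : P ⊆ Nᶜ := hPN.subset_compl_right
  have hPP : MapsTo g P P := hgP.mono_left hPN'
  have hcontr : ContractingWith K (hPP.restrict g P P) :=
    ⟨hK, (hLP.mapsToRestrict hPP)⟩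
  obtain ⟨p₀, hp₀⟩ := hPne
  obtain ⟨p, hpP, hpfix, -⟩ := hcontr.exists_fixedPoint' hP.isComplete hPP hp₀ (edist_ne_top _ _)
  have huniq : ∀ q ∈ P, g q = q → q = p := fun q hq hfix => by
    have h1 := hLP.dist_le_mul q hq p hpP
    rw [hfix, hpfix] at h1
    have hK' : (K : ℝ) < 1 := hK
    exact dist_le_zero.1 (by nlinarith [dist_nonneg (x := q) (y := p)])
  have hlimP : ∀ y ∈ P, Tendsto (fun k => g^[k] y) atTop (𝓝 p) := fun y hy => by
    obtain ⟨q, hqP, hqfix, hq, -⟩ :=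
      hcontr.exists_fixedPoint' hP.isComplete hPP hy (edist_ne_top _ _)
    rwa [huniq q hqP hqfix] at hq
  have hlim : ∀ y ∈ Nᶜ, Tendsto (fun k => g^[k] y) atTop (𝓝 p) := fun y hy => by
    rw [← tendsto_add_atTop_iff_nat 1]
    exact hlimP _ (hgP hy)
  refine ⟨p, ⟨hpfix, Nᶜ, hN.isOpen_compl, hPN' hpP, hlim⟩, ?_⟩
  rintro x ⟨hxfix, U, hU, hxU, hxlim⟩
  by_cases hxN : x ∈ N
  · exfalso
    obtain ⟨y, ⟨hyU, -⟩, hyx⟩ :=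
      (preperfect_iff_nhds.1 PerfectSpace.univ_preperfect) x (mem_univ x) U (hU.mem_nhds hxU)
    have hy := hxlim y hyU
    have hstay : ∀ k, g^[k] y ∈ N := fun k => by
      by_contra hk
      have h1 := hlim _ hk
      simp only [← iterate_add_apply] at h1
      have h2 := tendsto_nhds_unique h1 ((tendsto_add_atTop_iff_nat k).2 hy)
      exact hPN.ne_of_mem hpP hxN h2
    have hgrow : ∀ k, dist y x ≤ dist (g^[k] y) x := fun k => by
      induction k with
      | zero => exact le_rfl
      | succ k ih =>
        have h1 := hLN.dist_le_mul _ (hstay (k + 1)) x hxN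
        have h2 : g⁻¹ x = x := by
          conv_lhs => rw [← hxfix]
          exact g.inv_apply_self' x
        have h3 : g⁻¹ (g^[k + 1] y) = g^[k] y := by
          rw [iterate_succ_apply', g.inv_apply_self']
        rw [h2, h3] at h1
        have hK' : (K : ℝ) < 1 := hK
        nlinarith [dist_nonneg (x := g^[k + 1] y) (y := x)]
    have h0 : Tendsto (fun k => dist (g^[k] y) x) atTop (𝓝 0) :=
      tendsto_iff_dist_tendsto_zero.1 hy
    exact hyx (dist_le_zero.1 (ge_of_tendsto' h0 hgrow))
  · refine huniq x ?_ hxfix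
    rw [← hxfix]
    exact hgP hxN

variable {α : Type*}

/-- The homeomorphism attached to a letter of the free group. -/
def letterHomeo [TopologicalSpace X] (f : α → X ≃ₜ X) (s : α × Bool) : X ≃ₜ X :=
  cond s.2 (f s.1) (f s.1)⁻¹

/-- A contracting ping-pong configuration for the homeomorphisms `f`. -/
structure IsContractingPingPong [MetricSpace X] (f : α → X ≃ₜ X) (C : α × Bool → Set X)
    (K : ℝ≥0) : Prop where
  lt_one : K < 1
  isClosed : ∀ s, IsClosed (C s)
  nonempty : ∀ s, (C s).Nonempty
  disjoint : ∀ s t, s ≠ t → Disjoint (C s) (C t)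
  mapsTo : ∀ s, MapsTo (letterHomeo f s) (C (s.1, !s.2))ᶜ (C s)
  lipschitz : ∀ s t, t ≠ (s.1, !s.2) → LipschitzOnWith K (letterHomeo f s) (C t)

namespace IsContractingPingPong

variable [MetricSpace X] {f : α → X ≃ₜ X} {C : α × Bool → Set X} {K : ℝ≥0}

theorem mapsTo_letter (h : IsContractingPingPong f C K) {s t : α × Bool}
    (hst : s.1 = t.1 → s.2 = t.2) : MapsTo (letterHomeo f s) (C t) (C s) :=
  (h.mapsTo s).mono_left <| Disjoint.subset_compl_right <| h.disjoint _ _ fun he => by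
    subst he; simp at hst

theorem lipschitz_letter (h : IsContractingPingPong f C K) {s t : α × Bool}
    (hst : s.1 = t.1 → s.2 = t.2) : LipschitzOnWith K (letterHomeo f s) (C t) :=
  h.lipschitz _ _ fun he => by subst he; simp at hst

theorem mapsTo_and_lipschitz_word (h : IsContractingPingPong f C K) (s : α × Bool) :
    ∀ (L : List (α × Bool)) (t : α × Bool), FreeGroup.IsReduced (s :: L ++ [t]) →
      MapsTo (FreeGroup.lift f (FreeGroup.mk (s :: L))) (C t) (C s) ∧
      LipschitzOnWith K (FreeGroup.lift f (FreeGroup.mk (s :: L))) (C t) := by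
  intro L
  induction L generalizing s with
  | nil =>
    intro t ht
    have hst : s.1 = t.1 → s.2 = t.2 := by simpa using ht
    have : FreeGroup.lift f (FreeGroup.mk [s]) = letterHomeo f s := by
      simp [FreeGroup.lift_mk, letterHomeo]
    rw [this]
    exact ⟨h.mapsTo_letter hst, h.lipschitz_letter hst⟩
  | cons r L ih =>
    intro t ht
    simp only [List.cons_append, FreeGroup.isReduced_cons_cons] at ht
    obtain ⟨hm, hl⟩ := ih r t ht.2
    have : FreeGroup.lift f (FreeGroup.mk (s :: r :: L)) =
        letterHomeo f s * FreeGroup.lift f (FreeGroup.mk (r :: L)) := by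
      simp [FreeGroup.lift_mk, letterHomeo]
    rw [this, Homeomorph.coe_mul']
    refine ⟨(h.mapsTo_letter ht.1).comp hm, ?_⟩
    refine ((h.lipschitz_letter ht.1).comp hl hm).weaken ?_
    exact mul_le_of_le_one_left' h.lt_one.le

theorem mapsTo_compl_word (h : IsContractingPingPong f C K) {s t : α × Bool}
    {L M : List (α × Bool)} (hL : s :: L = M ++ [t]) (hred : FreeGroup.IsReduced (s :: L)) :
    MapsTo (FreeGroup.lift f (FreeGroup.mk (s :: L))) (C (t.1, !t.2))ᶜ (C s) := by
  cases M with
  | nil =>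
    simp only [List.nil_append, List.cons.injEq] at hL
    obtain ⟨rfl, rfl⟩ := hL
    have : FreeGroup.lift f (FreeGroup.mk [s]) = letterHomeo f s := by
      simp [FreeGroup.lift_mk, letterHomeo]
    rw [this]
    exact h.mapsTo s
  | cons r M =>
    obtain ⟨rfl, rfl⟩ : s = r ∧ L = M ++ [t] := by simpa using hL
    have : FreeGroup.lift f (FreeGroup.mk (s :: (M ++ [t]))) =
        FreeGroup.lift f (FreeGroup.mk (s :: M)) * letterHomeo f t := by
      simp [FreeGroup.lift_mk, letterHomeo, mul_assoc]
    rw [this, Homeomorph.coe_mul']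
    exact (h.mapsTo_and_lipschitz_word s M t hred).1.comp (h.mapsTo t)

theorem northSouth_word (h : IsContractingPingPong f C K) {s t : α × Bool}
    {L M : List (α × Bool)} (hL : s :: L = M ++ [t])
    (hred : FreeGroup.IsReduced (s :: L)) (hts : t.1 = s.1 → t.2 = s.2) :
    MapsTo (FreeGroup.lift f (FreeGroup.mk (s :: L))) (C (t.1, !t.2))ᶜ (C s) ∧
      LipschitzOnWith K (FreeGroup.lift f (FreeGroup.mk (s :: L))) (C s) := by
  refine ⟨h.mapsTo_compl_word hL hred, (h.mapsTo_and_lipschitz_word s L s ?_).2⟩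
  rw [hL, List.append_assoc]
  rw [hL] at hred
  rw [← List.append_assoc]
  exact hred.append_overlap (by simpa using hts) (by simp)

theorem existsUnique_of_isCyclicallyReduced [CompleteSpace X] [PerfectSpace X]
    (h : IsContractingPingPong f C K) {L : List (α × Bool)}
    (hL : FreeGroup.IsCyclicallyReduced L) (hne : L ≠ []) :
    ∃! x, IsAttractingFixedPt (FreeGroup.lift f (FreeGroup.mk L)) x := by
  classical
  obtain ⟨s, L', rfl⟩ := List.exists_cons_of_ne_nil hne
  obtain ⟨M, t, hM⟩ := (List.eq_nil_or_concat (s :: L')).resolve_left hne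
  rw [List.concat_eq_append] at hM
  obtain ⟨hred, hcyc⟩ := hL
  have hts : t.1 = s.1 → t.2 = s.2 := hcyc t (by simp [hM]) s (by simp)
  obtain ⟨hm, hl⟩ := h.northSouth_word hM hred hts
  have hinv : FreeGroup.invRev (s :: L') = (t.1, !t.2) :: FreeGroup.invRev M := by
    rw [hM]; simp [FreeGroup.invRev]
  have hinv' : (t.1, !t.2) :: FreeGroup.invRev M = FreeGroup.invRev L' ++ [(s.1, !s.2)] := by
    rw [← hinv]; simp [FreeGroup.invRev]
  have hred' : FreeGroup.IsReduced ((t.1, !t.2) :: FreeGroup.invRev M) := by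
    rw [← hinv, FreeGroup.isReduced_iff_reduce_eq, FreeGroup.reduce_invRev, hred.reduce_eq]
  obtain ⟨-, hl'⟩ := h.northSouth_word hinv' hred'
    (fun he => by simpa using (hts he.symm).symm)
  rw [← hinv, ← FreeGroup.inv_mk, map_inv] at hl'
  refine existsUnique_isAttractingFixedPt_of_northSouth h.lt_one (h.isClosed _) (h.isClosed _)
    (h.nonempty _) (h.disjoint _ _ ?_) hm hl hl'
  rintro rfl
  simp at hts

theorem existsUnique [CompleteSpace X] [PerfectSpace X] (h : IsContractingPingPong f C K)
    {w : FreeGroup α} (hw : w ≠ 1) : ∃! x, IsAttractingFixedPt (FreeGroup.lift f w) x := by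
  classical
  have hconj := FreeGroup.reduceCyclically.conj_conjugator_reduceCyclically w.toWord
  have hcyc := FreeGroup.reduceCyclically.isCyclicallyReduced (FreeGroup.isReduced_toWord (x := w))
  set c := FreeGroup.reduceCyclically.conjugator w.toWord
  set r := FreeGroup.reduceCyclically w.toWord
  have hwr : w = FreeGroup.mk c * FreeGroup.mk r * (FreeGroup.mk c)⁻¹ := by
    rw [FreeGroup.inv_mk, FreeGroup.mul_mk, FreeGroup.mul_mk, hconj, FreeGroup.mk_toWord]
  have hr : r ≠ [] := fun hr => hw <| by
    rw [hwr, hr, ← FreeGroup.one_eq_mk, mul_one, mul_inv_cancel]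
  rw [hwr, map_mul, map_mul, map_inv]
  exact existsUnique_isAttractingFixedPt_conj (h.existsUnique_of_isCyclicallyReduced hcyc hr) _

theorem lift_injective [CompleteSpace X] [PerfectSpace X] (h : IsContractingPingPong f C K) :
    Injective (FreeGroup.lift f) := by
  refine (injective_iff_map_eq_one _).2 fun w hw => ?_
  by_contra hne
  obtain ⟨x, hx, -⟩ := h.existsUnique hne
  rw [hw] at hx
  exact not_isAttractingFixedPt_one x hx

end IsContractingPingPong

end PingPong

section Circle

/-- The restriction to `[0, 1]` of a strictly increasing continuous map with `G 1 = G 0 + 1` extends to a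
homeomorphism of `ℝ` commuting with the translation by `1`. -/
theorem exists_homeomorph_extension {G : ℝ → ℝ} (hc : Continuous G) (hm : StrictMono G)
    (h1 : G 1 = G 0 + 1) :
    ∃ F : ℝ ≃ₜ ℝ, StrictMono F ∧ (∀ t, F (t + 1) = F t + 1) ∧ ∀ t ∈ Icc (0 : ℝ) 1, F t = G t := by
  set F₀ : ℝ → ℝ := fun t => G (Int.fract t) + ⌊t⌋ with hF₀
  have hmono : StrictMono F₀ := by
    intro s t hst
    rcases (Int.floor_mono hst.le).eq_or_lt with h | h
    · have : Int.fract s < Int.fract t := by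
        rw [← Int.self_sub_floor, ← Int.self_sub_floor, h]; linarith
      simp only [hF₀, h]
      linarith [hm this]
    · have ha : G (Int.fract s) < G 1 := hm (Int.fract_lt_one s)
      have hb : G 0 ≤ G (Int.fract t) := hm.monotone (Int.fract_nonneg t)
      have hk : (⌊s⌋ : ℝ) + 1 ≤ ⌊t⌋ := by exact_mod_cast h
      simp only [hF₀]
      linarith
  have hsurj : Surjective F₀ := by
    intro y
    set k := ⌊y - G 0⌋
    have hk1 : (k : ℝ) ≤ y - G 0 := Int.floor_le _
    have hk2 : y - G 0 < k + 1 := Int.lt_floor_add_one _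
    obtain ⟨x, ⟨hx0, hx1⟩, hx⟩ := intermediate_value_Ico zero_le_one (hc.continuousOn (s := Icc 0 1))
      (show y - k ∈ Ico (G 0) (G 1) from ⟨by linarith, by linarith⟩)
    refine ⟨x + k, ?_⟩
    have h0 : ⌊x⌋ = 0 := Int.floor_eq_zero_iff.2 ⟨hx0, hx1⟩
    simp only [hF₀, Int.fract_add_intCast, Int.floor_add_intCast, h0, zero_add,
      Int.fract_eq_self.2 ⟨hx0, hx1⟩, hx]
    ring
  refine ⟨(hmono.orderIsoOfSurjective F₀ hsurj).toHomeomorph, hmono, fun t => ?_, fun t ht => ?_⟩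
  · change F₀ (t + 1) = F₀ t + 1
    simp only [hF₀, Int.fract_add_one, Int.floor_add_one]
    push_cast
    ring
  · change F₀ t = G t
    rcases ht.2.eq_or_lt with rfl | h
    · simp [hF₀, h1]
    · simp [hF₀, Int.fract_eq_self.2 ⟨ht.1, h⟩, Int.floor_eq_zero_iff.2 ⟨ht.1, h⟩]

theorem exists_circleMap {F : ℝ → ℝ} (hc : Continuous F) (hF : ∀ t, F (t + 1) = F t + 1) :
    ∃ f : Circle1 → Circle1, Continuous f ∧ ∀ t : ℝ, f t = F t := by
  have hper : Periodic (fun t => (F t : Circle1)) 1 := fun t => by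
    simp only [hF, AddCircle.coe_add_period]
  refine ⟨hper.lift, ?_, fun t => rfl⟩
  exact continuous_coinduced_dom.2 ((AddCircle.continuous_mk' 1).comp hc)

theorem exists_circleHomeomorph (F : ℝ ≃ₜ ℝ) (hF : ∀ t, F (t + 1) = F t + 1) :
    ∃ f : Circle1 ≃ₜ Circle1, ∀ t : ℝ, f t = F t := by
  have hF' : ∀ t, F.symm (t + 1) = F.symm t + 1 := fun t => by
    rw [F.symm_apply_eq, hF, F.apply_symm_apply]
  obtain ⟨f, hfc, hf⟩ := exists_circleMap F.continuous hF
  obtain ⟨g, hgc, hg⟩ := exists_circleMap F.symm.continuous hF'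
  refine ⟨⟨⟨f, g, fun x => ?_, fun x => ?_⟩, hfc, hgc⟩, hf⟩
  · induction x using QuotientAddGroup.induction_on with
    | H t => exact (congrArg g (hf t)).trans ((hg _).trans (by rw [F.symm_apply_apply]))
  · induction x using QuotientAddGroup.induction_on with
    | H t => exact (congrArg f (hg t)).trans ((hf _).trans (by rw [F.apply_symm_apply]))

/-- The image in the circle of the interval `[u, v]`. -/
def circleArc (u v : ℝ) : Set Circle1 := (fun t : ℝ => (t : Circle1)) '' Icc u v

theorem isClosed_circleArc (u v : ℝ) : IsClosed (circleArc u v) :=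
  (isCompact_Icc.image (AddCircle.continuous_mk' 1)).isClosed

theorem nonempty_circleArc {u v : ℝ} (h : u ≤ v) : (circleArc u v).Nonempty :=
  (nonempty_Icc.2 h).image _

theorem coe_add_intCast_circle (t : ℝ) (k : ℤ) : ((t + k : ℝ) : Circle1) = t := by
  rw [AddCircle.coe_add, (AddCircle.coe_eq_zero_iff 1 (x := (k : ℝ))).2 ⟨k, by simp⟩, add_zero]

theorem circleArc_add_intCast (u v : ℝ) (k : ℤ) :
    circleArc (u + k) (v + k) = circleArc u v := by
  rw [circleArc, ← image_add_const_Icc, image_image]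
  simp only [coe_add_intCast_circle, circleArc]

theorem disjoint_circleArc {u v u' v' : ℝ} (h : v < u') (h' : v' < u + 1) :
    Disjoint (circleArc u v) (circleArc u' v') := by
  rw [Set.disjoint_left]
  rintro _ ⟨s, hs, rfl⟩ ⟨t, ht, hst⟩
  have : ((t : ℝ) : Circle1) = (s : ℝ) := hst
  rw [AddCircle.coe_eq_coe_iff_of_mem_Ico (a := u) (p := 1)
    ⟨by linarith [hs.1, hs.2, ht.1], by linarith [ht.2]⟩
    ⟨hs.1, by linarith [hs.1, hs.2, ht.1, ht.2]⟩] at this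
  linarith [hs.2, ht.1]

theorem lipschitzOnWith_circleArc {f : Circle1 → Circle1} {F : ℝ → ℝ}
    (hf : ∀ t : ℝ, f t = F t) {K : ℝ≥0} {u v : ℝ} (huv : v - u ≤ 1 / 2)
    (hF : ∀ x ∈ Icc u v, ∀ y ∈ Icc u v, |F x - F y| ≤ K * |x - y|) :
    LipschitzOnWith K f (circleArc u v) := by
  refine LipschitzOnWith.of_dist_le_mul ?_
  rintro _ ⟨x, hx, rfl⟩ _ ⟨y, hy, rfl⟩
  have hxy : |x - y| ≤ 1 / 2 := abs_sub_le_iff.2 ⟨by linarith [hx.2, hy.1], by linarith [hy.2, hx.1]⟩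
  have h1 : dist (x : Circle1) (y : Circle1) = |x - y| := by
    rw [dist_eq_norm, ← AddCircle.coe_sub]
    exact (AddCircle.norm_coe_eq_abs_iff 1 one_ne_zero).2 (by simpa using hxy)
  have h2 : dist (F x : Circle1) (F y : Circle1) ≤ |F x - F y| := by
    rw [dist_eq_norm, ← AddCircle.coe_sub, UnitAddCircle.norm_eq]
    simpa using round_le (F x - F y) 0
  simp only [hf, h1]
  exact h2.trans (hF x hx y hy)

/-- `F` is a lift of the circle homeomorphism `f` mapping `[u₀, u₁]` onto `[v₁ - 1, v₀]` with
expansion at least `K⁻¹`, and `[u₁, u₀ + 1]` onto `[v₀, v₁]` with contraction at least `K`. -/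
structure IsHyperbolicLift (f : Circle1 ≃ₜ Circle1) (F : ℝ ≃ₜ ℝ) (K : ℝ≥0)
    (u₀ u₁ v₀ v₁ : ℝ) : Prop where
  strictMono : StrictMono F
  map_add_one : ∀ t, F (t + 1) = F t + 1
  apply_coe : ∀ t : ℝ, f t = F t
  apply_left : F u₀ = v₁ - 1
  apply_right : F u₁ = v₀
  contracting : ∀ x ∈ Icc u₁ (u₀ + 1), ∀ y ∈ Icc u₁ (u₀ + 1), |F x - F y| ≤ K * |x - y|
  expanding : ∀ x ∈ Icc u₀ u₁, ∀ y ∈ Icc u₀ u₁, |x - y| ≤ K * |F x - F y|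

namespace IsHyperbolicLift

variable {f : Circle1 ≃ₜ Circle1} {F : ℝ ≃ₜ ℝ} {K : ℝ≥0} {u₀ u₁ v₀ v₁ : ℝ}

theorem inv_apply_coe (h : IsHyperbolicLift f F K u₀ u₁ v₀ v₁) (t : ℝ) :
    f⁻¹ (t : Circle1) = (F.symm t : ℝ) := by
  conv_lhs => rw [← F.apply_symm_apply t, ← h.apply_coe]
  exact f.inv_apply_self' _

theorem mapsTo (h : IsHyperbolicLift f F K u₀ u₁ v₀ v₁) :
    MapsTo f (circleArc u₀ u₁)ᶜ (circleArc v₀ v₁) := by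
  intro x hx
  obtain ⟨t, ht, rfl⟩ := (AddCircle.coe_image_Ico_eq (1 : ℝ) u₀).ge (mem_univ x)
  have htu : u₁ ≤ t := by
    by_contra! hlt
    exact hx ⟨t, ⟨ht.1, hlt.le⟩, rfl⟩
  have h0 := h.strictMono.monotone htu
  have h1 := h.strictMono.monotone ht.2.le
  rw [h.map_add_one, h.apply_left, sub_add_cancel] at h1
  rw [h.apply_right] at h0
  exact ⟨F t, ⟨h0, h1⟩, (h.apply_coe t).symm⟩

theorem mapsTo_inv (h : IsHyperbolicLift f F K u₀ u₁ v₀ v₁) :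
    MapsTo ⇑f⁻¹ (circleArc v₀ v₁)ᶜ (circleArc u₀ u₁) := by
  intro x hx
  obtain ⟨t, ht, rfl⟩ := (AddCircle.coe_image_Ico_eq (1 : ℝ) (v₁ - 1)).ge (mem_univ x)
  have htv : t ≤ v₀ := by
    by_contra! hlt
    exact hx ⟨t, ⟨hlt.le, by linarith [ht.2]⟩, rfl⟩
  refine ⟨F.symm t, ⟨?_, ?_⟩, (h.inv_apply_coe t).symm⟩
  · rw [← h.strictMono.le_iff_le, F.apply_symm_apply, h.apply_left]
    exact ht.1
  · rw [← h.strictMono.le_iff_le, F.apply_symm_apply, h.apply_right]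
    exact htv

theorem lipschitzOnWith (h : IsHyperbolicLift f F K u₀ u₁ v₀ v₁) {u v : ℝ} (k : ℤ)
    (hu : u₁ ≤ u + k) (hv : v + k ≤ u₀ + 1) (huv : v - u ≤ 1 / 2) :
    LipschitzOnWith K f (circleArc u v) := by
  rw [← circleArc_add_intCast u v k]
  refine lipschitzOnWith_circleArc h.apply_coe (by linarith) fun x hx y hy => ?_
  exact h.contracting x (Icc_subset_Icc hu hv hx) y (Icc_subset_Icc hu hv hy)

theorem lipschitzOnWith_inv (h : IsHyperbolicLift f F K u₀ u₁ v₀ v₁) {u v : ℝ} (k : ℤ)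
    (hu : v₁ - 1 ≤ u + k) (hv : v + k ≤ v₀) (huv : v - u ≤ 1 / 2) :
    LipschitzOnWith K ⇑f⁻¹ (circleArc u v) := by
  rw [← circleArc_add_intCast u v k]
  refine lipschitzOnWith_circleArc h.inv_apply_coe (by linarith) fun x hx y hy => ?_
  have hmem : ∀ x ∈ Icc (u + k) (v + k), F.symm x ∈ Icc u₀ u₁ := fun x hx => by
    constructor
    · rw [← h.strictMono.le_iff_le, F.apply_symm_apply, h.apply_left]
      exact hu.trans hx.1
    · rw [← h.strictMono.le_iff_le, F.apply_symm_apply, h.apply_right]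
      exact hx.2.trans hv
  simpa using h.expanding _ (hmem x hx) _ (hmem y hy)

end IsHyperbolicLift

/-- Two circle homeomorphisms with hyperbolic lifts differing by a small translation play
ping-pong. -/
theorem isContractingPingPong_of_isHyperbolicLift {a b : Circle1 ≃ₜ Circle1} {F G : ℝ ≃ₜ ℝ}
    {K : ℝ≥0} {c p w q : ℝ} (hK : K < 1) (hc : 0 < c) (hcp : c < p) (hpw : p < w) (hwq : w < q)
    (hq : q ≤ 1 / 2) (ha : IsHyperbolicLift a F K 0 c p w)
    (hb : IsHyperbolicLift b G K (-q) (c - q) (p - q) (w - q)) :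
    IsContractingPingPong ![a, b]
      (fun s => circleArc ((cond s.2 p 0) - ![0, q] s.1) ((cond s.2 w c) - ![0, q] s.1)) K where
  lt_one := hK
  isClosed _ := isClosed_circleArc _ _
  nonempty := by
    rintro ⟨i, _ | _⟩ <;> apply nonempty_circleArc <;> simp <;> linarith
  disjoint := by
    rintro ⟨i, x⟩ ⟨j, y⟩ hne
    fin_cases i <;> fin_cases j <;> cases x <;> cases y <;> simp at hne ⊢ <;>
    first
    | (apply disjoint_circleArc <;> linarith)
    | (apply Disjoint.symm; apply disjoint_circleArc <;> linarith)
  mapsTo := by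
    rintro ⟨i, x⟩
    fin_cases i <;> cases x <;> simp [letterHomeo]
    · exact ha.mapsTo_inv
    · exact ha.mapsTo
    · exact hb.mapsTo_inv
    · exact hb.mapsTo
  lipschitz := by
    rintro ⟨i, x⟩ ⟨j, y⟩ hne
    fin_cases i <;> fin_cases j <;> cases x <;> cases y <;> simp [letterHomeo] at hne ⊢
    all_goals first
    | (apply ha.lipschitzOnWith_inv 0 <;> push_cast <;> linarith)
    | (apply ha.lipschitzOnWith 0 <;> push_cast <;> linarith)
    | (apply ha.lipschitzOnWith 1 <;> push_cast <;> linarith)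
    | (apply hb.lipschitzOnWith_inv 0 <;> push_cast <;> linarith)
    | (apply hb.lipschitzOnWith_inv (-1) <;> push_cast <;> linarith)
    | (apply hb.lipschitzOnWith 0 <;> push_cast <;> linarith)

end Circle

section Construction

/-- The model piecewise linear map, a minimum of three affine maps of slopes `q⁻²`, `q²`, `q⁴`. -/
def modelMap (q t : ℝ) : ℝ :=
  min ((q ^ 2)⁻¹ * (t - (q ^ 2 - q ^ 5)) + q ^ 2)
    (min (q ^ 2 * (t - (q ^ 2 - q ^ 5)) + q ^ 2) (q ^ 4 * (t - 1) + (q ^ 2 + q ^ 3)))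

variable {q t : ℝ}

theorem continuous_modelMap (q : ℝ) : Continuous (modelMap q) := by
  unfold modelMap
  fun_prop

theorem strictMono_modelMap (hq : 0 < q) : StrictMono (modelMap q) := by
  have h : ∀ {m : ℝ} (a b : ℝ), 0 < m → StrictMono fun t => m * (t - a) + b :=
    fun a b hm s t hst => by
      have := mul_lt_mul_of_pos_left (sub_lt_sub_right hst a) hm
      simpa using this
  exact fun s t hst => min_lt_min (h _ _ (by positivity) hst)
    (min_lt_min (h _ _ (by positivity) hst) (h _ _ (by positivity) hst))

theorem slope_bounds (hq : 0 < q) (hq2 : q ≤ 1 / 2) :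
    q ^ 4 ≤ q ^ 2 ∧ q ^ 2 ≤ 1 / 4 ∧ q ^ 2 ≤ (q ^ 2)⁻¹ ∧ 4 ≤ (q ^ 2)⁻¹ := by
  have h1 : q ^ 2 ≤ 1 / 4 := by nlinarith
  have h2 : q ^ 4 ≤ q ^ 2 := by nlinarith [sq_nonneg q]
  have h3 : 4 ≤ (q ^ 2)⁻¹ := by
    rw [le_inv_comm₀ (by norm_num) (by positivity)]
    linarith
  exact ⟨h2, h1, by linarith, h3⟩

theorem modelMap_of_le (hq : 0 < q) (hq2 : q ≤ 1 / 2) (ht : t ≤ q ^ 2 - q ^ 5) :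
    modelMap q t = (q ^ 2)⁻¹ * (t - (q ^ 2 - q ^ 5)) + q ^ 2 := by
  obtain ⟨h1, h2, h3, h4⟩ := slope_bounds hq hq2
  have h5 : 0 < q ^ 5 := by positivity
  have h6 : 0 < q ^ 3 := by positivity
  have ha : (q ^ 2)⁻¹ * (t - (q ^ 2 - q ^ 5)) ≤ q ^ 2 * (t - (q ^ 2 - q ^ 5)) :=
    mul_le_mul_of_nonpos_right h3 (by linarith)
  have hb : q ^ 2 * (t - (q + q ^ 3)) ≤ q ^ 4 * (t - (q + q ^ 3)) :=
    mul_le_mul_of_nonpos_right h1 (by nlinarith)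
  exact min_eq_left (le_min (by linarith) (by linarith))

theorem modelMap_of_mem (hq : 0 < q) (hq2 : q ≤ 1 / 2) (ht : q ^ 2 - q ^ 5 ≤ t)
    (ht' : t ≤ q + q ^ 3) :
    modelMap q t = q ^ 2 * (t - (q ^ 2 - q ^ 5)) + q ^ 2 := by
  obtain ⟨h1, h2, h3, h4⟩ := slope_bounds hq hq2
  have ha : q ^ 2 * (t - (q ^ 2 - q ^ 5)) ≤ (q ^ 2)⁻¹ * (t - (q ^ 2 - q ^ 5)) :=
    mul_le_mul_of_nonneg_right h3 (by linarith)
  have hb : q ^ 2 * (t - (q + q ^ 3)) ≤ q ^ 4 * (t - (q + q ^ 3)) :=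
    mul_le_mul_of_nonpos_right h1 (by linarith)
  rw [modelMap, min_eq_left (b := q ^ 4 * (t - 1) + (q ^ 2 + q ^ 3)) (by linarith)]
  exact min_eq_right (by linarith)

theorem modelMap_of_ge (hq : 0 < q) (hq2 : q ≤ 1 / 2) (ht : q + q ^ 3 ≤ t) :
    modelMap q t = q ^ 4 * (t - 1) + (q ^ 2 + q ^ 3) := by
  obtain ⟨h1, h2, h3, h4⟩ := slope_bounds hq hq2
  have h5 : 0 < q ^ 5 := by positivity
  have h6 : 0 < q ^ 3 := by positivity
  have ha : q ^ 2 * (t - (q ^ 2 - q ^ 5)) ≤ (q ^ 2)⁻¹ * (t - (q ^ 2 - q ^ 5)) :=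
    mul_le_mul_of_nonneg_right h3 (by nlinarith)
  have hb : q ^ 4 * (t - (q + q ^ 3)) ≤ q ^ 2 * (t - (q + q ^ 3)) :=
    mul_le_mul_of_nonneg_right h1 (by linarith)
  rw [modelMap, min_eq_right (b := q ^ 4 * (t - 1) + (q ^ 2 + q ^ 3)) (by linarith)]
  exact min_eq_right (by linarith)

theorem modelMap_zero (hq : 0 < q) (hq2 : q ≤ 1 / 2) : modelMap q 0 = q ^ 2 + q ^ 3 - 1 := by
  have h : 0 ≤ q ^ 2 - q ^ 5 := by
    have : q ^ 3 ≤ 1 := pow_le_one₀ hq.le (by linarith)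
    nlinarith [sq_nonneg q]
  rw [modelMap_of_le hq hq2 h]
  field_simp
  ring

theorem modelMap_one (hq : 0 < q) (hq2 : q ≤ 1 / 2) : modelMap q 1 = q ^ 2 + q ^ 3 := by
  have h : q + q ^ 3 ≤ 1 := by nlinarith [slope_bounds hq hq2]
  rw [modelMap_of_ge hq hq2 h]
  ring

theorem abs_modelMap_sub_le (hq : 0 < q) (hq2 : q ≤ 1 / 2) {x y : ℝ} (hx : q ^ 2 - q ^ 5 ≤ x)
    (hy : q ^ 2 - q ^ 5 ≤ y) : |modelMap q x - modelMap q y| ≤ 1 / 4 * |x - y| := by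
  wlog hxy : y ≤ x generalizing x y
  · rw [abs_sub_comm, abs_sub_comm x]
    exact this hy hx (le_of_not_ge hxy)
  obtain ⟨h1, h2, h3, h4⟩ := slope_bounds hq hq2
  have h5 : 0 ≤ q ^ 4 := by positivity
  rw [abs_of_nonneg (sub_nonneg.2 ((strictMono_modelMap hq).monotone hxy)),
    abs_of_nonneg (sub_nonneg.2 hxy)]
  rcases le_total (q + q ^ 3) y with hy' | hy'
  · rw [modelMap_of_ge hq hq2 hy', modelMap_of_ge hq hq2 (hy'.trans hxy)]
    nlinarith
  · rw [modelMap_of_mem hq hq2 hy hy']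
    have : modelMap q x ≤ q ^ 2 * (x - (q ^ 2 - q ^ 5)) + q ^ 2 :=
      (min_le_right _ _).trans (min_le_left _ _)
    nlinarith

theorem abs_sub_le_modelMap (hq : 0 < q) (hq2 : q ≤ 1 / 2) {x y : ℝ} (hx : x ≤ q ^ 2 - q ^ 5)
    (hy : y ≤ q ^ 2 - q ^ 5) : |x - y| ≤ 1 / 4 * |modelMap q x - modelMap q y| := by
  obtain ⟨h1, h2, h3, h4⟩ := slope_bounds hq hq2
  rw [modelMap_of_le hq hq2 hx, modelMap_of_le hq hq2 hy,
    show (q ^ 2)⁻¹ * (x - (q ^ 2 - q ^ 5)) + q ^ 2 - ((q ^ 2)⁻¹ * (y - (q ^ 2 - q ^ 5)) + q ^ 2) =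
      (q ^ 2)⁻¹ * (x - y) by ring, abs_mul, abs_of_pos (by linarith : 0 < (q ^ 2)⁻¹)]
  nlinarith [abs_nonneg (x - y)]

theorem exists_isHyperbolicLift (hq : 0 < q) (hq2 : q ≤ 1 / 2) :
    ∃ (a : Circle1 ≃ₜ Circle1) (F : ℝ ≃ₜ ℝ),
      IsHyperbolicLift a F (1 / 4) 0 (q ^ 2 - q ^ 5) (q ^ 2) (q ^ 2 + q ^ 3) ∧
      ∀ t ∈ Icc (0 : ℝ) 1, F t = modelMap q t := by
  obtain ⟨F, hF, hF1, hFG⟩ := exists_homeomorph_extension (continuous_modelMap q)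
    (strictMono_modelMap hq) (by rw [modelMap_zero hq hq2, modelMap_one hq hq2]; ring)
  obtain ⟨a, ha⟩ := exists_circleHomeomorph F hF1
  have hc0 : 0 ≤ q ^ 2 - q ^ 5 := by
    have : q ^ 3 ≤ 1 := pow_le_one₀ hq.le (by linarith)
    nlinarith [sq_nonneg q]
  have hc1 : q ^ 2 - q ^ 5 ≤ 1 := by
    have : 0 < q ^ 5 := by positivity
    linarith [slope_bounds hq hq2]
  refine ⟨a, F, ⟨hF, hF1, ha, ?_, ?_, fun x hx y hy => ?_, fun x hx y hy => ?_⟩, hFG⟩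
  · rw [hFG 0 (by simp), modelMap_zero hq hq2]
  · rw [hFG _ ⟨hc0, hc1⟩, modelMap_of_le hq hq2 le_rfl]
    simp
  · rw [zero_add] at hx hy
    rw [hFG x ⟨hc0.trans hx.1, hx.2⟩, hFG y ⟨hc0.trans hy.1, hy.2⟩]
    simpa using abs_modelMap_sub_le hq hq2 hx.1 hy.1
  · rw [hFG x ⟨hx.1, hx.2.trans hc1⟩, hFG y ⟨hy.1, hy.2.trans hc1⟩]
    simpa using abs_sub_le_modelMap hq hq2 hx.2 hy.2

/-- Conjugating a hyperbolic lift by a translation. -/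
theorem IsHyperbolicLift.exists_translate {f : Circle1 ≃ₜ Circle1} {F : ℝ ≃ₜ ℝ} {K : ℝ≥0}
    {u₀ u₁ v₀ v₁ : ℝ} (h : IsHyperbolicLift f F K u₀ u₁ v₀ v₁) (q : ℝ) :
    ∃ (g : Circle1 ≃ₜ Circle1) (G : ℝ ≃ₜ ℝ),
      IsHyperbolicLift g G K (u₀ - q) (u₁ - q) (v₀ - q) (v₁ - q) ∧ ∀ t, G t = F (t + q) - q := by
  set G : ℝ ≃ₜ ℝ := ((Homeomorph.addRight q).trans F).trans (Homeomorph.addRight (-q))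
  have hG : ∀ t, G t = F (t + q) - q := fun t => rfl
  have hG1 : ∀ t, G (t + 1) = G t + 1 := fun t => by
    rw [hG, hG, add_right_comm, h.map_add_one]; ring
  obtain ⟨g, hg⟩ := exists_circleHomeomorph G hG1
  refine ⟨g, G, ⟨fun s t hst => ?_, hG1, hg, ?_, ?_, fun x hx y hy => ?_, fun x hx y hy => ?_⟩, hG⟩
  · rw [hG, hG]
    linarith [h.strictMono (add_lt_add_left hst q)]
  · rw [hG, sub_add_cancel, h.apply_left]; ring
  · rw [hG, sub_add_cancel, h.apply_right]
  · have := h.contracting (x + q) ⟨by linarith [hx.1], by linarith [hx.2]⟩ (y + q)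
      ⟨by linarith [hy.1], by linarith [hy.2]⟩
    simpa [hG] using this
  · have := h.expanding (x + q) ⟨by linarith [hx.1], by linarith [hx.2]⟩ (y + q)
      ⟨by linarith [hy.1], by linarith [hy.2]⟩
    simpa [hG] using this

/-- A map of the form `t ↦ M (t - a) + b` on an interval is affine of slope `n ^ m` when
`M = n ^ m`. -/
theorem exists_affine_of_eqOn {n : ℕ} {F : ℝ → ℝ} {u v M a b : ℝ} (m : ℤ) (hM : M = (n : ℝ) ^ m)
    (h : ∀ t ∈ Icc u v, F t = M * (t - a) + b) :
    ∃ (m : ℤ) (c : ℝ), ∀ t ∈ Icc u v, F t = (n : ℝ) ^ m * t + c :=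
  ⟨m, b - M * a, fun t ht => by rw [h t ht, ← hM]; ring⟩

theorem isPiecewiseLinearN_modelMap {n : ℕ} (hn : 2 ≤ n) (hqn : q = (n : ℝ)⁻¹) {F : ℝ → ℝ}
    (hF : ∀ t ∈ Icc (0 : ℝ) 1, F t = modelMap q t) : IsPiecewiseLinearN n F := by
  have hn0 : (0 : ℝ) < n := by positivity
  have hq : 0 < q := by rw [hqn]; positivity
  have hq2 : q ≤ 1 / 2 := by
    rw [hqn, one_div]; exact inv_anti₀ two_pos (by exact_mod_cast hn)
  obtain ⟨h1, h2, h3, h4⟩ := slope_bounds hq hq2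
  have h5 : 0 < q ^ 3 := by positivity
  have h6 : 0 < q ^ 5 := by positivity
  have h7 : q ^ 5 < q ^ 2 := pow_lt_pow_right_of_lt_one₀ hq (by linarith) (by norm_num)
  have h8 : q ^ 3 ≤ q ^ 2 := pow_le_pow_of_le_one hq.le (by linarith) (by norm_num)
  have h9 : q ^ 2 ≤ q / 2 := by nlinarith
  refine ⟨3, ![0, q ^ 2 - q ^ 5, q + q ^ 3, 1] ∘ Fin.ofNat 4, by norm_num, rfl, rfl, ?_, ?_, ?_⟩
  · intro i hi
    interval_cases i
    · change 0 < q ^ 2 - q ^ 5; linarith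
    · change q ^ 2 - q ^ 5 < q + q ^ 3; linarith
    · change q + q ^ 3 < 1; linarith
  · intro i hi
    subst hqn
    interval_cases i
    · exact ⟨0, 0, by simp⟩
    · change IsNAdicRational n ((n : ℝ)⁻¹ ^ 2 - (n : ℝ)⁻¹ ^ 5)
      exact ⟨n ^ 3 - 1, 5, by simp; field_simp⟩
    · exact ⟨n ^ 2 + 1, 3, by simp; field_simp⟩
    · exact ⟨1, 0, by simp⟩
  · intro i hi
    interval_cases i
    · refine exists_affine_of_eqOn 2 (M := (q ^ 2)⁻¹) (a := q ^ 2 - q ^ 5) (b := q ^ 2)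
        (by simp [hqn]) fun t ht => ?_
      change t ∈ Icc 0 (q ^ 2 - q ^ 5) at ht
      rw [hF t ⟨ht.1, by linarith [ht.2]⟩, modelMap_of_le hq hq2 ht.2]
    · refine exists_affine_of_eqOn (-2) (M := q ^ 2) (a := q ^ 2 - q ^ 5) (b := q ^ 2)
        (by simp [hqn, zpow_neg]) fun t ht => ?_
      change t ∈ Icc (q ^ 2 - q ^ 5) (q + q ^ 3) at ht
      rw [hF t ⟨by linarith [ht.1], by linarith [ht.2]⟩, modelMap_of_mem hq hq2 ht.1 ht.2]
    · refine exists_affine_of_eqOn (-4) (M := q ^ 4) (a := 1) (b := q ^ 2 + q ^ 3)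
        (by simp [hqn, zpow_neg]) fun t ht => ?_
      change t ∈ Icc (q + q ^ 3) 1 at ht
      rw [hF t ⟨by linarith [ht.1], ht.2⟩, modelMap_of_ge hq hq2 ht.1]

theorem isPiecewiseLinearN_translate {n : ℕ} (hn : 2 ≤ n) (hqn : q = (n : ℝ)⁻¹) {F G : ℝ → ℝ}
    (hF : ∀ t ∈ Icc (0 : ℝ) 1, F t = modelMap q t) (hF1 : ∀ t, F (t + 1) = F t + 1)
    (hG : ∀ t, G t = F (t + q) - q) : IsPiecewiseLinearN n G := by
  have hn0 : (0 : ℝ) < n := by positivity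
  have hq : 0 < q := by rw [hqn]; positivity
  have hq2 : q ≤ 1 / 2 := by
    rw [hqn, one_div]; exact inv_anti₀ two_pos (by exact_mod_cast hn)
  obtain ⟨h1, h2, h3, h4⟩ := slope_bounds hq hq2
  have h5 : 0 < q ^ 3 := by positivity
  have h6 : 0 < q ^ 5 := by positivity
  have h7 : q ^ 5 < q ^ 2 := pow_lt_pow_right_of_lt_one₀ hq (by linarith) (by norm_num)
  have h8 : q ^ 3 ≤ q ^ 2 := pow_le_pow_of_le_one hq.le (by linarith) (by norm_num)
  have h9 : q ^ 2 ≤ q / 2 := by nlinarith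
  have hG' : ∀ t, G t = F (t + q - 1) + 1 - q := fun t => by
    rw [hG, ← hF1, sub_add_cancel]
  refine ⟨4, ![0, q ^ 3, 1 - q, 1 - q + (q ^ 2 - q ^ 5), 1] ∘ Fin.ofNat 5, by norm_num, rfl, rfl,
    ?_, ?_, ?_⟩
  · intro i hi
    interval_cases i
    · change 0 < q ^ 3; linarith
    · change q ^ 3 < 1 - q; linarith
    · change 1 - q < 1 - q + (q ^ 2 - q ^ 5); linarith
    · change 1 - q + (q ^ 2 - q ^ 5) < 1; linarith
  · intro i hi
    subst hqn
    interval_cases i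
    · exact ⟨0, 0, by simp⟩
    · change IsNAdicRational n ((n : ℝ)⁻¹ ^ 3)
      exact ⟨1, 3, by simp⟩
    · exact ⟨n - 1, 1, by simp; field_simp⟩
    · exact ⟨n ^ 5 - n ^ 4 + n ^ 3 - 1, 5, by simp; field_simp; ring⟩
    · exact ⟨1, 0, by simp⟩
  · intro i hi
    interval_cases i
    · refine exists_affine_of_eqOn (-2) (M := q ^ 2) (a := q ^ 2 - q ^ 5 - q) (b := q ^ 2 - q)
        (by simp [hqn, zpow_neg]) fun t ht => ?_
      change t ∈ Icc 0 (q ^ 3) at ht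
      rw [hG, hF _ ⟨by linarith [ht.1], by linarith [ht.2]⟩,
        modelMap_of_mem hq hq2 (by linarith [ht.1]) (by linarith [ht.2])]
      ring
    · refine exists_affine_of_eqOn (-4) (M := q ^ 4) (a := 1 - q) (b := q ^ 2 + q ^ 3 - q)
        (by simp [hqn, zpow_neg]) fun t ht => ?_
      change t ∈ Icc (q ^ 3) (1 - q) at ht
      rw [hG, hF _ ⟨by linarith [ht.1], by linarith [ht.2]⟩,
        modelMap_of_ge hq hq2 (by linarith [ht.1])]
      ring
    · refine exists_affine_of_eqOn 2 (M := (q ^ 2)⁻¹) (a := q ^ 2 - q ^ 5 - q + 1)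
        (b := q ^ 2 + 1 - q) (by simp [hqn]) fun t ht => ?_
      change t ∈ Icc (1 - q) (1 - q + (q ^ 2 - q ^ 5)) at ht
      rw [hG', hF _ ⟨by linarith [ht.1], by linarith [ht.2]⟩,
        modelMap_of_le hq hq2 (by linarith [ht.2])]
      ring
    · refine exists_affine_of_eqOn (-2) (M := q ^ 2) (a := q ^ 2 - q ^ 5 - q + 1)
        (b := q ^ 2 + 1 - q) (by simp [hqn, zpow_neg]) fun t ht => ?_
      change t ∈ Icc (1 - q + (q ^ 2 - q ^ 5)) 1 at ht
      rw [hG', hF _ ⟨by linarith [ht.1], by linarith [ht.2]⟩,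
        modelMap_of_mem hq hq2 (by linarith [ht.1]) (by linarith [ht.2])]
      ring

theorem exists_isContractingPingPong_of_tnMem {n : ℕ} (hn : 2 ≤ n) :
    ∃ (a b : Circle1 ≃ₜ Circle1) (C : Fin 2 × Bool → Set Circle1) (K : ℝ≥0),
      TnMem n a ∧ TnMem n b ∧ IsContractingPingPong ![a, b] C K := by
  obtain ⟨q, hqn⟩ : ∃ q : ℝ, q = (n : ℝ)⁻¹ := ⟨_, rfl⟩
  have hn0 : (0 : ℝ) < n := by positivity
  have hq : 0 < q := by rw [hqn]; positivity
  have hq2 : q ≤ 1 / 2 := by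
    rw [hqn, one_div]; exact inv_anti₀ two_pos (by exact_mod_cast hn)
  have h3 : 0 < q ^ 3 := by positivity
  have h5 : 0 < q ^ 5 := by positivity
  have h7 : q ^ 5 < q ^ 2 := pow_lt_pow_right_of_lt_one₀ hq (by linarith) (by norm_num)
  have h9 : q ^ 2 ≤ q / 2 := by nlinarith
  have h10 : q ^ 3 < q ^ 2 := pow_lt_pow_right_of_lt_one₀ hq (by linarith) (by norm_num)
  obtain ⟨a, F, ha, hF⟩ := exists_isHyperbolicLift hq hq2
  obtain ⟨b, G, hb, hG⟩ := ha.exists_translate q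
  rw [zero_sub] at hb
  refine ⟨a, b, _, 1 / 4,
    ⟨F, ha.strictMono, ha.map_add_one, ha.apply_coe, isPiecewiseLinearN_modelMap hn hqn hF⟩,
    ⟨G, hb.strictMono, hb.map_add_one, hb.apply_coe,
      isPiecewiseLinearN_translate hn hqn hF ha.map_add_one hG⟩,
    isContractingPingPong_of_isHyperbolicLift ?_ ?_ ?_ ?_ ?_ hq2 ha hb⟩
  · rw [← NNReal.coe_lt_coe]; norm_num
  all_goals linarith

end Construction

instance : Nontrivial Circle1 :=
  ⟨((1 / 2 : ℝ) : Circle1), 0, fun h => by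
    rw [AddCircle.coe_eq_zero_iff_of_mem_Ico ⟨by norm_num, by norm_num⟩] at h
    norm_num at h⟩

/-- For every `n ≥ 2` there exist `a, b ∈ T_n` generating a free subgroup of rank 2 in
which every non-trivial element has exactly one attracting fixed point in `S¹`. -/
theorem exists_free_subgroup_unique_attracting (n : ℕ) (hn : 2 ≤ n) :
    ∃ a b : Circle1 ≃ₜ Circle1, TnMem n a ∧ TnMem n b ∧
      Function.Injective ⇑(FreeGroup.lift ![a, b]) ∧
      ∀ g ∈ Subgroup.closure ({a, b} : Set (Circle1 ≃ₜ Circle1)), g ≠ 1 →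
        ∃! x : Circle1, IsAttractingFixedPt (⇑g) x := by
  obtain ⟨a, b, C, K, ha, hb, hab⟩ := exists_isContractingPingPong_of_tnMem hn
  refine ⟨a, b, ha, hb, hab.lift_injective, fun g hg hne => ?_⟩
  have hrange : Set.range ![a, b] = {a, b} := by
    simp [Matrix.range_cons, Set.pair_comm]
  rw [← hrange, ← FreeGroup.range_lift_eq_closure] at hg
  obtain ⟨w, rfl⟩ := hg
  exact hab.existsUnique fun hw => hne (by rw [hw, map_one])
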